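/- Let B be a Hopf algebra over a field k with bijective antipode S, A a left B-module algebra, V a left Yetter–Drinfeld module over B, and W a k-vector space which is a left A-module (a·w) and a left B-module (b·w) satisfying b·(a·w) = (b₍₁₎·a)·(b₍₂₎·w). Then V⊗W, equipped with the A-action a⋆(v⊗w) := v₍₀₎ ⊗ ((S⁻¹(v₍₋₁₎)·a)·w) and the B-action b·(v⊗w) := (b₍₁₎·v)⊗(b₍₂₎·w), is again a left A-module and left B-module satisfying b·(a⋆x) = (b₍₁₎·a)⋆(b₍₂₎·x) for all x ∈ V⊗W. -/

import Mathlib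

/-!
STATEMENT 4: For a Hopf algebra `B` with bijective antipode, a left `B`-module algebra `A`,
a left Yetter–Drinfeld module `V`, and a space `W` which is a left `A`-module and left
`B`-module with `b·(a·w) = (b₍₁₎·a)·(b₍₂₎·w)`, the tensor product `V ⊗ W` with
`a ⋆ (v⊗w) = v₍₀₎ ⊗ ((S⁻¹(v₍₋₁₎)·a)·w)` and `b·(v⊗w) = (b₍₁₎·v)⊗(b₍₂₎·w)` satisfies the
same compatibilities.
-/

open scoped TensorProduct

noncomputable section

/-- The `A`-action `a ⋆ (v ⊗ w) = v₍₀₎ ⊗ ((S⁻¹(v₍₋₁₎) · a) · w)` on `V ⊗ W`. -/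
def starAction {k B A V W : Type} [Field k] [Ring B] [Bialgebra k B]
    [Ring A] [Algebra k A] [AddCommGroup V] [Module k V] [AddCommGroup W] [Module k W]
    (Sinv : B →ₗ[k] B) (δV : V →ₗ[k] B ⊗[k] V)
    (actA : B →ₗ[k] A →ₗ[k] A) (actW : A →ₗ[k] W →ₗ[k] W) :
    A ⊗[k] (V ⊗[k] W) →ₗ[k] V ⊗[k] W :=
  LinearMap.lTensor V (TensorProduct.lift actW)
    ∘ₗ LinearMap.lTensor V
        (LinearMap.rTensor W (TensorProduct.lift actA ∘ₗ LinearMap.rTensor A Sinv))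
    ∘ₗ (TensorProduct.assoc k V (B ⊗[k] A) W).toLinearMap
    ∘ₗ LinearMap.rTensor W (LinearMap.lTensor V (TensorProduct.comm k A B).toLinearMap)
    ∘ₗ LinearMap.rTensor W (TensorProduct.comm k (A ⊗[k] B) V).toLinearMap
    ∘ₗ LinearMap.rTensor W (TensorProduct.assoc k A B V).symm.toLinearMap
    ∘ₗ (TensorProduct.assoc k A (B ⊗[k] V) W).symm.toLinearMap
    ∘ₗ LinearMap.lTensor A (LinearMap.rTensor W δV)

/-- The tensor product action `b · (v ⊗ w) = (b₍₁₎ · v) ⊗ (b₍₂₎ · w)`. -/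
def tensorAction {k B V W : Type} [Field k] [Ring B] [Bialgebra k B]
    [AddCommGroup V] [Module k V] [AddCommGroup W] [Module k W]
    (actV : B →ₗ[k] V →ₗ[k] V) (actW : B →ₗ[k] W →ₗ[k] W) :
    B ⊗[k] (V ⊗[k] W) →ₗ[k] V ⊗[k] W :=
  TensorProduct.map (TensorProduct.lift actV) (TensorProduct.lift actW)
    ∘ₗ (TensorProduct.tensorTensorTensorComm k B B V W).toLinearMap
    ∘ₗ LinearMap.rTensor (V ⊗[k] W) (Coalgebra.comul (R := k))


section Helpers

open Coalgebra HopfAlgebra LinearMap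

variable {k B : Type} [Field k] [Ring B]

/-- Convolution `b ↦ m (f b₍₁₎) (g b₍₂₎)`. -/
def cv [Bialgebra k B] {X Y Z : Type} [AddCommGroup X] [Module k X] [AddCommGroup Y] [Module k Y]
    [AddCommGroup Z] [Module k Z] (m : X →ₗ[k] Y →ₗ[k] Z) (f : B →ₗ[k] X) (g : B →ₗ[k] Y) :
    B →ₗ[k] Z :=
  TensorProduct.lift m ∘ₗ TensorProduct.map f g ∘ₗ comul

section
variable [Bialgebra k B] {X Y Z U T R : Type} [AddCommGroup X] [Module k X]
    [AddCommGroup Y] [Module k Y] [AddCommGroup Z] [Module k Z] [AddCommGroup U] [Module k U]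
    [AddCommGroup T] [Module k T] [AddCommGroup R] [Module k R]

lemma cv_sum (m : X →ₗ[k] Y →ₗ[k] Z) (f : B →ₗ[k] X) (g : B →ₗ[k] Y) (b : B) (n : ℕ)
    (b1 b2 : Fin n → B) (h : comul (R := k) b = ∑ i, b1 i ⊗ₜ[k] b2 i) :
    cv m f g b = ∑ i, m (f (b1 i)) (g (b2 i)) := by
  simp [cv, h]

lemma exists_fin_comul (b : B) : ∃ (n : ℕ) (b1 b2 : Fin n → B),
    comul (R := k) b = ∑ i, b1 i ⊗ₜ[k] b2 i := by
  obtain ⟨s, hs⟩ := TensorProduct.exists_finset (R := k) (comul (R := k) b)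
  refine ⟨s.card, fun i => (s.equivFin.symm i).1.1, fun i => (s.equivFin.symm i).1.2, ?_⟩
  rw [hs, ← Finset.sum_coe_sort, ← s.equivFin.symm.sum_comp]

lemma cv_assoc (m1 : X →ₗ[k] Y →ₗ[k] U) (m2 : U →ₗ[k] Z →ₗ[k] R)
    (m3 : Y →ₗ[k] Z →ₗ[k] T) (m4 : X →ₗ[k] T →ₗ[k] R)
    (h : ∀ x y z, m2 (m1 x y) z = m4 x (m3 y z))
    (f : B →ₗ[k] X) (g : B →ₗ[k] Y) (l : B →ₗ[k] Z) :
    cv m2 (cv m1 f g) l = cv m4 f (cv m3 g l) := by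
  ext b
  have key := coassoc_apply (R := k) b
  let L : B ⊗[k] (B ⊗[k] B) →ₗ[k] R :=
    TensorProduct.lift m4 ∘ₗ TensorProduct.map f (TensorProduct.lift m3 ∘ₗ TensorProduct.map g l)
  have h1 : ∀ x : B ⊗[k] B, ∀ c : B, L (TensorProduct.assoc k B B B (x ⊗ₜ c)) =
      m2 (TensorProduct.lift m1 (TensorProduct.map f g x)) (l c) := by
    intro x c
    induction x with
    | zero => simp
    | add x y hx hy => simp only [TensorProduct.add_tmul, map_add, hx, hy, LinearMap.add_apply]
    | tmul x y => simp [L, h]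
  have h2 : ∀ x : B ⊗[k] B, TensorProduct.lift m2 (TensorProduct.map (cv m1 f g) l x) =
      L (TensorProduct.assoc k B B B (comul.rTensor B x)) := by
    intro x
    induction x with
    | zero => simp
    | add x y hx hy => simp only [map_add, hx, hy]
    | tmul x y => rw [rTensor_tmul, h1]; simp [cv]
  have h3 : ∀ x : B ⊗[k] B, TensorProduct.lift m4 (TensorProduct.map f (cv m3 g l) x) =
      L (comul.lTensor B x) := by
    intro x
    induction x with
    | zero => simp
    | add x y hx hy => simp only [map_add, hx, hy]
    | tmul x y => simp [cv, L]
  have e1 := h2 (comul b)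
  have e2 := h3 (comul b)
  rw [key, ← e2] at e1
  exact e1

lemma cv_unit_left (m : X →ₗ[k] Y →ₗ[k] Y) (e : X) (he : ∀ y, m e y = y) (g : B →ₗ[k] Y)
    (u : B →ₗ[k] X) (hu : ∀ b, u b = counit (R := k) b • e) : cv m u g = g := by
  ext b
  have h : ∀ x : B ⊗[k] B, TensorProduct.lift m (TensorProduct.map u g x) =
      g (TensorProduct.lid k B (counit.rTensor B x)) := by
    intro x
    induction x with
    | zero => simp
    | add x y hx hy => simp only [map_add, hx, hy]
    | tmul x y => simp [hu, he]
  simpa using! h (comul b)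

lemma cv_unit_right (m : Y →ₗ[k] X →ₗ[k] Y) (e : X) (he : ∀ y, m y e = y) (g : B →ₗ[k] Y)
    (u : B →ₗ[k] X) (hu : ∀ b, u b = counit (R := k) b • e) : cv m g u = g := by
  ext b
  have h : ∀ x : B ⊗[k] B, TensorProduct.lift m (TensorProduct.map g u x) =
      g (TensorProduct.rid k B (counit.lTensor B x)) := by
    intro x
    induction x with
    | zero => simp
    | add x y hx hy => simp only [map_add, hx, hy]
    | tmul x y => simp [hu, he]
  simpa using! h (comul b)

lemma tensorAction_eq {V W : Type} [AddCommGroup V] [Module k V] [AddCommGroup W] [Module k W]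
    (actV : B →ₗ[k] V →ₗ[k] V) (bW : B →ₗ[k] W →ₗ[k] W) (b : B) (n : ℕ)
    (b1 b2 : Fin n → B) (h : comul (R := k) b = ∑ i, b1 i ⊗ₜ[k] b2 i) (v : V) (w : W) :
    tensorAction actV bW (b ⊗ₜ (v ⊗ₜ w)) = ∑ i, actV (b1 i) v ⊗ₜ[k] bW (b2 i) w := by
  simp [tensorAction, h, TensorProduct.sum_tmul]

/-- `β ⊗ u ↦ u ⊗ ((S⁻¹(β) · a) · w)`. -/
def starF {A V W : Type} [Ring A] [Algebra k A] [AddCommGroup V] [Module k V]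
    [AddCommGroup W] [Module k W] (Sinv : B →ₗ[k] B)
    (actA : B →ₗ[k] A →ₗ[k] A) (actW : A →ₗ[k] W →ₗ[k] W) (a : A) (w : W) :
    B ⊗[k] V →ₗ[k] V ⊗[k] W :=
  lTensor V (actW.flip w ∘ₗ actA.flip a ∘ₗ Sinv) ∘ₗ (TensorProduct.comm k B V).toLinearMap

@[simp] lemma starF_tmul {A V W : Type} [Ring A] [Algebra k A] [AddCommGroup V] [Module k V]
    [AddCommGroup W] [Module k W] (Sinv : B →ₗ[k] B)
    (actA : B →ₗ[k] A →ₗ[k] A) (actW : A →ₗ[k] W →ₗ[k] W) (a : A) (w : W) (β : B) (u : V) :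
    starF Sinv actA actW a w (β ⊗ₜ u) = u ⊗ₜ[k] actW (actA (Sinv β) a) w := by
  simp [starF]

lemma starAction_eq {A V W : Type} [Ring A] [Algebra k A] [AddCommGroup V] [Module k V]
    [AddCommGroup W] [Module k W] (Sinv : B →ₗ[k] B) (δV : V →ₗ[k] B ⊗[k] V)
    (actA : B →ₗ[k] A →ₗ[k] A) (actW : A →ₗ[k] W →ₗ[k] W) (a : A) (v : V) (w : W) :
    starAction Sinv δV actA actW (a ⊗ₜ (v ⊗ₜ w)) = starF Sinv actA actW a w (δV v) := by
  simp only [starAction, LinearMap.comp_apply, lTensor_tmul, rTensor_tmul]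
  generalize δV v = x
  induction x with
  | zero => simp
  | add x y hx hy => simp only [map_add, TensorProduct.add_tmul, TensorProduct.tmul_add, hx, hy]
  | tmul x y => simp

end

section Hopf
variable [HopfAlgebra k B]

lemma comul_antipode :
    comul ∘ₗ antipode k (A := B) = TensorProduct.map (antipode k) (antipode k) ∘ₗ
      (TensorProduct.comm k B B).toLinearMap ∘ₗ comul := by
  let i1 : B →ₐ[k] B ⊗[k] B := Algebra.TensorProduct.includeLeft
  let i2 : B →ₐ[k] B ⊗[k] B := Algebra.TensorProduct.includeRight
  let μ := LinearMap.mul k (B ⊗[k] B)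
  let S := antipode k (A := B)
  have hG : TensorProduct.map S S ∘ₗ
      (TensorProduct.comm k B B).toLinearMap ∘ₗ comul =
      cv μ (i2.toLinearMap ∘ₗ S) (i1.toLinearMap ∘ₗ S) := by
    ext b
    obtain ⟨n, b1, b2, h⟩ := exists_fin_comul (k := k) b
    rw [cv_sum _ _ _ _ _ _ _ h]
    simp [h, μ, i1, i2]
  have hD : comul = cv μ i1.toLinearMap i2.toLinearMap := by
    ext b
    obtain ⟨n, b1, b2, h⟩ := exists_fin_comul (k := k) b
    rw [cv_sum _ _ _ _ _ _ _ h]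
    simp [h, μ, i1, i2]
  have hinv : ∀ i : B →ₐ[k] B ⊗[k] B, ∀ b,
      cv μ (i.toLinearMap ∘ₗ S) i.toLinearMap b = counit (R := k) b • 1 := by
    intro i b
    obtain ⟨n, b1, b2, h⟩ := exists_fin_comul (k := k) b
    rw [cv_sum _ _ _ _ _ _ _ h]
    have := mul_antipode_rTensor_comul_apply (R := k) b
    rw [h] at this
    have := congrArg i this
    simpa [μ, S, Algebra.smul_def] using this
  have hμ : ∀ x y z, μ (μ x y) z = μ x (μ y z) := fun x y z => mul_assoc x y z
  have hright : ∀ b, cv μ comul (comul ∘ₗ S) b = counit (R := k) b • 1 := by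
    intro b
    obtain ⟨n, b1, b2, h⟩ := exists_fin_comul (k := k) b
    rw [cv_sum _ _ _ _ _ _ _ h]
    have := mul_antipode_lTensor_comul_apply (R := k) b
    rw [h] at this
    have := congrArg (Bialgebra.comulAlgHom k B) this
    simpa [μ, S, Algebra.smul_def] using this
  have hleft : ∀ b, cv μ (cv μ (i2.toLinearMap ∘ₗ S) (i1.toLinearMap ∘ₗ S)) comul b
      = counit (R := k) b • 1 := by
    intro b
    rw [hD, cv_assoc μ μ μ μ hμ, ← cv_assoc μ μ μ μ hμ (i1.toLinearMap ∘ₗ S),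
      cv_unit_left μ 1 (by simp [μ]) _ _ (hinv i1), hinv i2]
  rw [hG]
  change comul ∘ₗ S = _
  rw [← cv_unit_right μ 1 (by simp [μ]) (cv μ (i2.toLinearMap ∘ₗ S) (i1.toLinearMap ∘ₗ S)) _ hright,
    ← cv_assoc μ μ μ μ hμ, cv_unit_left μ 1 (by simp [μ]) _ _ hleft]

end Hopf

end Helpers

theorem tensor_action_left_module_algebra
    {k B A V W : Type} [Field k] [Ring B] [HopfAlgebra k B]
    [Ring A] [Algebra k A] [AddCommGroup V] [Module k V] [AddCommGroup W] [Module k W]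
    -- the antipode is bijective, with (linear) inverse `Sinv`
    (Sinv : B →ₗ[k] B)
    (hS1 : ∀ b : B, Sinv (HopfAlgebra.antipode (R := k) b) = b)
    (hS2 : ∀ b : B, HopfAlgebra.antipode (R := k) (Sinv b) = b)
    -- `A` is a left `B`-module algebra
    (actA : B →ₗ[k] A →ₗ[k] A)
    (hactA1 : ∀ a : A, actA 1 a = a)
    (hactAm : ∀ (b b' : B) (a : A), actA (b * b') a = actA b (actA b' a))
    (hactAalg : ∀ (b : B) (a a' : A) (n : ℕ) (b1 b2 : Fin n → B),
      Coalgebra.comul (R := k) b = ∑ i, b1 i ⊗ₜ[k] b2 i →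
      actA b (a * a') = ∑ i, actA (b1 i) a * actA (b2 i) a')
    (hactAone : ∀ b : B, actA b (1 : A) = Coalgebra.counit (R := k) b • (1 : A))
    -- `V` is a left Yetter–Drinfeld module over `B`
    (actV : B →ₗ[k] V →ₗ[k] V)
    (hactV1 : ∀ v : V, actV 1 v = v)
    (hactVm : ∀ (b b' : B) (v : V), actV (b * b') v = actV b (actV b' v))
    (δV : V →ₗ[k] B ⊗[k] V)
    (hδV1 : ∀ v : V, (TensorProduct.assoc k B B V)
        ((LinearMap.rTensor V (Coalgebra.comul (R := k))) (δV v))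
        = (LinearMap.lTensor B δV) (δV v))
    (hδV2 : ∀ v : V, (TensorProduct.lid k V)
        ((LinearMap.rTensor V (Coalgebra.counit (R := k))) (δV v)) = v)
    (hYD : ∀ (b : B) (v : V) (n : ℕ) (b1 b2 : Fin n → B),
      Coalgebra.comul (R := k) b = ∑ i, b1 i ⊗ₜ[k] b2 i →
      ∑ i, TensorProduct.map (LinearMap.mulLeft k (b1 i)) (actV (b2 i)) (δV v)
        = ∑ i, LinearMap.rTensor V (LinearMap.mulRight k (b2 i)) (δV (actV (b1 i) v)))
    -- `W` is a left `A`-module and a left `B`-module with compatibility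
    (actW : A →ₗ[k] W →ₗ[k] W)
    (hactW1 : ∀ w : W, actW 1 w = w)
    (hactWm : ∀ (a a' : A) (w : W), actW (a * a') w = actW a (actW a' w))
    (bW : B →ₗ[k] W →ₗ[k] W)
    (hbW1 : ∀ w : W, bW 1 w = w)
    (hbWm : ∀ (b b' : B) (w : W), bW (b * b') w = bW b (bW b' w))
    (hWcompat : ∀ (b : B) (a : A) (w : W) (n : ℕ) (b1 b2 : Fin n → B),
      Coalgebra.comul (R := k) b = ∑ i, b1 i ⊗ₜ[k] b2 i →
      bW b (actW a w) = ∑ i, actW (actA (b1 i) a) (bW (b2 i) w)) :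
    -- `V ⊗ W` is a left `A`-module under `⋆`
    (∀ x : V ⊗[k] W, starAction Sinv δV actA actW ((1 : A) ⊗ₜ[k] x) = x) ∧
    (∀ (a a' : A) (x : V ⊗[k] W),
      starAction Sinv δV actA actW ((a * a') ⊗ₜ[k] x)
        = starAction Sinv δV actA actW (a ⊗ₜ[k] starAction Sinv δV actA actW (a' ⊗ₜ[k] x))) ∧
    -- `V ⊗ W` is a left `B`-module
    (∀ x : V ⊗[k] W, tensorAction actV bW ((1 : B) ⊗ₜ[k] x) = x) ∧
    (∀ (b b' : B) (x : V ⊗[k] W),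
      tensorAction actV bW ((b * b') ⊗ₜ[k] x)
        = tensorAction actV bW (b ⊗ₜ[k] tensorAction actV bW (b' ⊗ₜ[k] x))) ∧
    -- the compatibility `b·(a ⋆ x) = (b₍₁₎·a) ⋆ (b₍₂₎·x)`
    (∀ (b : B) (a : A) (x : V ⊗[k] W) (n : ℕ) (b1 b2 : Fin n → B),
      Coalgebra.comul (R := k) b = ∑ i, b1 i ⊗ₜ[k] b2 i →
      tensorAction actV bW (b ⊗ₜ[k] starAction Sinv δV actA actW (a ⊗ₜ[k] x))
        = ∑ i, starAction Sinv δV actA actW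
            ((actA (b1 i) a) ⊗ₜ[k] tensorAction actV bW (b2 i ⊗ₜ[k] x))) := by
  have hSinj : Function.Injective (HopfAlgebra.antipode k (A := B)) :=
    Function.LeftInverse.injective hS1
  have hSm : ∀ x y : B, Sinv (x * y) = Sinv y * Sinv x := by
    intro x y
    apply hSinj
    rw [HopfAlgebra.antipode_mul_antidistrib, hS2, hS2, hS2]
  have hSε : ∀ x : B, Coalgebra.counit (R := k) (Sinv x) = Coalgebra.counit (R := k) x := by
    intro x
    conv_rhs => rw [← hS2 x]
    rw [HopfAlgebra.counit_antipode]
  have hSΔ : ∀ x : B, Coalgebra.comul (R := k) (Sinv x) =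
      TensorProduct.map Sinv Sinv (TensorProduct.comm k B B (Coalgebra.comul (R := k) x)) := by
    intro x
    have h := LinearMap.congr_fun (comul_antipode (k := k) (B := B)) (Sinv x)
    simp only [LinearMap.comp_apply, hS2] at h
    rw [h]
    generalize Coalgebra.comul (R := k) (Sinv x) = y
    induction y with
    | zero => simp
    | add x y hx hy => simp only [map_add, ← hx, ← hy]
    | tmul x y => simp [hS1]
  have hΔ1 : Coalgebra.comul (R := k) (1 : B) = ∑ i : Fin 1, (1 : B) ⊗ₜ[k] (1 : B) := by
    simp [Algebra.TensorProduct.one_def]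
  refine ⟨?_, ?_, ?_, ?_, ?_⟩
  · intro x
    induction x with
    | zero => simp
    | add x y hx hy => rw [TensorProduct.tmul_add, map_add, hx, hy]
    | tmul v w =>
      rw [starAction_eq]
      have h : ∀ y : B ⊗[k] V, starF Sinv actA actW 1 w y =
          (TensorProduct.lid k V (LinearMap.rTensor V (Coalgebra.counit (R := k)) y)) ⊗ₜ w := by
        intro y
        induction y with
        | zero => simp
        | add x y hx hy => simp only [map_add, hx, hy, TensorProduct.add_tmul]
        | tmul β u => simp [hactAone, hSε, hactW1, TensorProduct.smul_tmul]
      rw [h, hδV2]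
  · intro a a' x
    induction x with
    | zero => simp
    | add x y hx hy => simp only [TensorProduct.tmul_add, map_add, hx, hy]
    | tmul v w =>
      rw [starAction_eq, starAction_eq]
      let H : B ⊗[k] (B ⊗[k] V) →ₗ[k] V ⊗[k] W :=
        TensorProduct.lift (LinearMap.mk₂ k
          (fun β x => starF Sinv actA actW a (actW (actA (Sinv β) a') w) x)
          (by
            intro β β' x
            induction x with
            | zero => simp
            | add x y hx hy => simp only [map_add] at hx hy ⊢; rw [hx, hy]; abel
            | tmul c u => simp [TensorProduct.tmul_add])
          (by
            intro c β x
            induction x with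
            | zero => simp
            | add x y hx hy => simp only [map_add, smul_add] at hx hy ⊢; rw [hx, hy]
            | tmul c u => simp)
          (by intros; simp)
          (by intros; simp))
      have hH : ∀ β x, H (β ⊗ₜ x) = starF Sinv actA actW a (actW (actA (Sinv β) a') w) x :=
        fun β x => rfl
      have h1 : ∀ y : B ⊗[k] V, starF Sinv actA actW (a * a') w y =
          H (TensorProduct.assoc k B B V (LinearMap.rTensor V (Coalgebra.comul (R := k)) y)) := by
        intro y
        induction y with
        | zero => simp
        | add x y hx hy => simp only [map_add, hx, hy]
        | tmul β u =>
          obtain ⟨n, b1, b2, h⟩ := exists_fin_comul (k := k) β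
          have h' : Coalgebra.comul (R := k) (Sinv β) =
              ∑ i, Sinv (b2 i) ⊗ₜ[k] Sinv (b1 i) := by
            rw [hSΔ, h]; simp
          rw [starF_tmul, hactAalg _ _ _ _ _ _ h', LinearMap.rTensor_tmul, h,
            TensorProduct.sum_tmul]
          simp only [map_sum, TensorProduct.assoc_tmul, hH, starF_tmul, LinearMap.sum_apply,
            TensorProduct.tmul_sum, hactWm]
      have h2 : ∀ y : B ⊗[k] V,
          starAction Sinv δV actA actW (a ⊗ₜ[k] starF Sinv actA actW a' w y) =
          H (LinearMap.lTensor B δV y) := by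
        intro y
        induction y with
        | zero => simp
        | add x y hx hy => simp only [map_add, TensorProduct.tmul_add, hx, hy]
        | tmul β u => rw [starF_tmul, starAction_eq, LinearMap.lTensor_tmul, hH]
      rw [h1, h2, hδV1]
  · intro x
    induction x with
    | zero => simp
    | add x y hx hy => rw [TensorProduct.tmul_add, map_add, hx, hy]
    | tmul v w =>
      rw [tensorAction_eq actV bW 1 1 (fun _ => 1) (fun _ => 1) hΔ1]
      simp [hactV1, hbW1]
  · intro b b' x
    induction x with
    | zero => simp
    | add x y hx hy => simp only [TensorProduct.tmul_add, map_add, hx, hy]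
    | tmul v w =>
      obtain ⟨n, b1, b2, h⟩ := exists_fin_comul (k := k) b
      obtain ⟨n', b1', b2', h'⟩ := exists_fin_comul (k := k) b'
      rw [tensorAction_eq actV bW b' _ _ _ h']
      simp only [TensorProduct.tmul_sum, map_sum, tensorAction_eq actV bW b _ _ _ h]
      simp only [tensorAction, LinearMap.comp_apply, LinearMap.rTensor_tmul, Bialgebra.comul_mul,
        h, h', Finset.sum_mul_sum, TensorProduct.sum_tmul, map_sum,
        Algebra.TensorProduct.tmul_mul_tmul]
      rw [Finset.sum_comm]
      simp [hactVm, hbWm]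
  · intro b a x n b1 b2 hb
    -- bimodule structure on `B ⊗ V`
    let Lm : B →ₗ[k] (B ⊗[k] V) →ₗ[k] (B ⊗[k] V) :=
      LinearMap.rTensorHom V ∘ₗ LinearMap.mul k B
    let Rm : (B ⊗[k] V) →ₗ[k] B →ₗ[k] (B ⊗[k] V) :=
      (LinearMap.rTensorHom V ∘ₗ (LinearMap.mul k B).flip).flip
    have hL : ∀ c β u, Lm c (β ⊗ₜ u) = (c * β) ⊗ₜ[k] u := fun c β u => rfl
    have hR : ∀ c β u, Rm (β ⊗ₜ u) c = (β * c) ⊗ₜ[k] u := fun c β u => rfl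
    have hLL : ∀ c d x, Lm (c * d) x = Lm c (Lm d x) := by
      intro c d x
      induction x with
      | zero => simp
      | add x y hx hy => simp only [map_add, hx, hy]
      | tmul β u => simp only [hL, mul_assoc]
    have hRR : ∀ c d x, Rm (Rm x c) d = Rm x (c * d) := by
      intro c d x
      induction x with
      | zero => simp
      | add x y hx hy => simp only [map_add, LinearMap.add_apply, hx, hy]
      | tmul β u => simp only [hR, mul_assoc]
    have hLR : ∀ c x d, Rm (Lm c x) d = Lm c (Rm x d) := by
      intro c x d
      induction x with
      | zero => simp
      | add x y hx hy => simp only [map_add, LinearMap.add_apply, hx, hy]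
      | tmul β u => simp only [hL, hR, mul_assoc]
    have hL1 : ∀ x, Lm 1 x = x := by
      intro x
      induction x with
      | zero => simp
      | add x y hx hy => simp only [map_add, hx, hy]
      | tmul β u => simp only [hL, one_mul]
    have hR1 : ∀ x, Rm x 1 = x := by
      intro x
      induction x with
      | zero => simp
      | add x y hx hy => simp only [map_add, LinearMap.add_apply, hx, hy]
      | tmul β u => simp only [hR, mul_one]
    let S := HopfAlgebra.antipode k (A := B)
    have hinv1 : ∀ b, cv (LinearMap.mul k B) S LinearMap.id b =
        Coalgebra.counit (R := k) b • (1 : B) := by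
      intro b
      obtain ⟨n, b1, b2, h⟩ := exists_fin_comul (k := k) b
      rw [cv_sum _ _ _ _ _ _ _ h]
      have := HopfAlgebra.mul_antipode_rTensor_comul_apply (R := k) b
      rw [h] at this
      simpa [S, Algebra.smul_def] using this
    have hinv2 : ∀ b, cv (LinearMap.mul k B) LinearMap.id S b =
        Coalgebra.counit (R := k) b • (1 : B) := by
      intro b
      obtain ⟨n, b1, b2, h⟩ := exists_fin_comul (k := k) b
      rw [cv_sum _ _ _ _ _ _ _ h]
      have := HopfAlgebra.mul_antipode_lTensor_comul_apply (R := k) b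
      rw [h] at this
      simpa [S, Algebra.smul_def] using this
    induction x with
    | zero => simp
    | add x y hx hy => simp only [TensorProduct.tmul_add, map_add, hx, hy, Finset.sum_add_distrib]
    | tmul v w =>
      let Q : B →ₗ[k] B ⊗[k] V := (LinearMap.lTensorHom B ∘ₗ actV).flip (δV v)
      let P : B →ₗ[k] B ⊗[k] V := δV ∘ₗ actV.flip v
      have hYD' : cv Lm LinearMap.id Q = cv Rm P LinearMap.id := by
        ext b
        obtain ⟨n, b1, b2, h⟩ := exists_fin_comul (k := k) b
        rw [cv_sum _ _ _ _ _ _ _ h, cv_sum _ _ _ _ _ _ _ h]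
        have := hYD b v n b1 b2 h
        simp only [← LinearMap.rTensor_comp_lTensor] at this
        exact this
      have key : cv Rm Q S = cv Lm S P := by
        rw [← cv_unit_right Rm 1 hR1 P _ hinv2,
          ← cv_assoc Rm Rm (LinearMap.mul k B) Rm (fun x c d => hRR c d x), ← hYD',
          cv_assoc Lm Rm Rm Lm hLR,
          ← cv_assoc (LinearMap.mul k B) Lm Lm Lm (fun c d x => hLL c d x),
          cv_unit_left Lm 1 hL1 _ _ hinv1]
      -- `β ⊗ u ↦ u ⊗ S⁻¹ β`
      let J : B ⊗[k] V →ₗ[k] V ⊗[k] B :=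
        (TensorProduct.comm k B V).toLinearMap ∘ₗ LinearMap.rTensor V Sinv
      have hJ : ∀ β u, J (β ⊗ₜ u) = u ⊗ₜ[k] Sinv β := fun β u => rfl
      let m : V ⊗[k] B →ₗ[k] W →ₗ[k] V ⊗[k] W :=
        (LinearMap.lTensorHom V ∘ₗ LinearMap.lcomp k W (actA.flip a) ∘ₗ actW.flip).flip
      have hm : ∀ u c w', m (u ⊗ₜ c) w' = u ⊗ₜ[k] actW (actA c a) w' := fun u c w' => rfl
      let p : B →ₗ[k] V →ₗ[k] V ⊗[k] B :=
        LinearMap.lcomp k (V ⊗[k] B) (J ∘ₗ δV) ∘ₗ LinearMap.lTensorHom V ∘ₗ (LinearMap.mul k B).flip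
      have hp : ∀ c u, p c u = LinearMap.lTensor V (LinearMap.mulRight k c) (J (δV u)) :=
        fun c u => rfl
      let nn : B →ₗ[k] V ⊗[k] W →ₗ[k] V ⊗[k] W :=
        (TensorProduct.mk k A (V ⊗[k] W)).compr₂ (starAction Sinv δV actA actW) ∘ₗ actA.flip a
      have hnn : ∀ c y, nn c y = starAction Sinv δV actA actW (actA c a ⊗ₜ y) := fun c y => rfl
      have hact : ∀ c u w', tensorAction actV bW (c ⊗ₜ (u ⊗ₜ w')) =
          cv (TensorProduct.mk k V W) (actV.flip u) (bW.flip w') c := by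
        intro c u w'
        obtain ⟨n, b1, b2, h⟩ := exists_fin_comul (k := k) c
        rw [cv_sum _ _ _ _ _ _ _ h, tensorAction_eq actV bW c _ _ _ h]
        rfl
      have hpm : ∀ c u w', m (p c u) w' = nn c (TensorProduct.mk k V W u w') := by
        intro c u w'
        rw [hnn, TensorProduct.mk_apply, starAction_eq, hp]
        generalize δV u = x
        induction x with
        | zero => simp
        | add x y hx hy => simp only [map_add, LinearMap.add_apply, hx, hy]
        | tmul β u =>
          rw [hJ, LinearMap.lTensor_tmul, hm, starF_tmul, LinearMap.mulRight_apply, hactAm]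
      have hE' : cv p LinearMap.id (actV.flip v) = J ∘ₗ cv Lm S P := by
        ext c
        obtain ⟨n, b1, b2, h⟩ := exists_fin_comul (k := k) c
        rw [LinearMap.comp_apply, cv_sum _ _ _ _ _ _ _ h, cv_sum _ _ _ _ _ _ _ h, map_sum]
        refine Finset.sum_congr rfl fun i _ => ?_
        rw [hp]
        change _ = J (Lm (S (b1 i)) (δV (actV (b2 i) v)))
        change LinearMap.lTensor V (LinearMap.mulRight k (b1 i)) (J (δV (actV (b2 i) v))) = _
        generalize δV (actV (b2 i) v) = x
        induction x with
        | zero => simp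
        | add x y hx hy => simp only [map_add, hx, hy]
        | tmul β u =>
          rw [hJ, LinearMap.lTensor_tmul, hL, hJ, hSm, hS1, LinearMap.mulRight_apply]
      have hrhs : ∑ i, starAction Sinv δV actA actW
            ((actA (b1 i) a) ⊗ₜ[k] tensorAction actV bW (b2 i ⊗ₜ[k] (v ⊗ₜ[k] w))) =
          cv m (cv p LinearMap.id (actV.flip v)) (bW.flip w) b := by
        rw [cv_assoc p m (TensorProduct.mk k V W) nn hpm, cv_sum _ _ _ _ _ _ _ hb]
        simp only [hnn, hact, LinearMap.id_apply]
      rw [hrhs, hE', ← key, starAction_eq]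
      have hlhs : ∀ x : B ⊗[k] V, tensorAction actV bW (b ⊗ₜ starF Sinv actA actW a w x) =
          cv m (J ∘ₗ cv Rm ((LinearMap.lTensorHom B ∘ₗ actV).flip x) S) (bW.flip w) b := by
        intro x
        induction x with
        | zero => simp [cv]
        | add x y hx hy =>
          rw [map_add, TensorProduct.tmul_add, map_add, hx, hy]
          simp only [cv, map_add, TensorProduct.map_add_left, LinearMap.comp_add,
            LinearMap.add_comp, LinearMap.add_apply]
        | tmul β u =>
          let m1 : V →ₗ[k] B →ₗ[k] V ⊗[k] B :=
            (TensorProduct.mk k V B).compl₂ (LinearMap.mulRight k (Sinv β))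
          let m3 : B →ₗ[k] W →ₗ[k] W := actW ∘ₗ actA.flip (actA (Sinv β) a)
          have e1 : bW.flip (actW (actA (Sinv β) a) w) = cv m3 LinearMap.id (bW.flip w) := by
            ext c
            obtain ⟨n, b1, b2, h⟩ := exists_fin_comul (k := k) c
            rw [cv_sum _ _ _ _ _ _ _ h]
            exact hWcompat c _ w n b1 b2 h
          have e2 : J ∘ₗ cv Rm ((LinearMap.lTensorHom B ∘ₗ actV).flip (β ⊗ₜ u)) S =
              cv m1 (actV.flip u) LinearMap.id := by
            ext c
            obtain ⟨n, b1, b2, h⟩ := exists_fin_comul (k := k) c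
            rw [LinearMap.comp_apply, cv_sum _ _ _ _ _ _ _ h, cv_sum _ _ _ _ _ _ _ h, map_sum]
            refine Finset.sum_congr rfl fun i _ => ?_
            change J (Rm (β ⊗ₜ actV (b1 i) u) (S (b2 i))) = actV (b1 i) u ⊗ₜ (b2 i * Sinv β)
            rw [hR, hJ, hSm, hS1]
          rw [starF_tmul, hact, e1, e2]
          refine (LinearMap.congr_fun (cv_assoc m1 m m3 (TensorProduct.mk k V W) ?_ _ _ _) b).symm
          intro u' c w'
          change m (u' ⊗ₜ (c * Sinv β)) w' = u' ⊗ₜ actW (actA c (actA (Sinv β) a)) w'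
          rw [hm, hactAm]
      exact hlhs (δV v)

end
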